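/- Consider a multi-unit auction with m ≥ 1 identical items and n single-minded bidders indexed 1,...,n, bidder i having demand d_i ∈ {1,...,m} and value x_i ≥ 0. The Single-Minded mechanism works as follows. With probability 1/2 it sells the grand bundle to a highest-value bidder, obtaining welfare max_i x_i. With the remaining probability 1/2 it draws independent fair coins σ : {1,...,n} → Bool, forms the sampled set S = {i : σ(i) = true}, sets the per-item price p = OPT(S)/(10m), and then processes the bidders not in S in increasing index order, maintaining a remaining supply r initialized to m: bidder i purchases d_i items (contributing x_i to the welfare and decreasing r by d_i) if and only if d_i ≤ r and x_i > p·d_i, and otherwise purchases nothing; let W(σ) denote the resulting total welfare. Then the expected welfare of the mechanism satisfies (1/2)·max_i x_i + (1/2)·E_σ[W(σ)] ≥ OPT/400, where OPT = OPT({1,...,n}); i.e., the mechanism is a 400-approximation to the optimal welfare. -/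

import Mathlib

open scoped Classical

/-- Optimal welfare attainable by allocating the `m` identical items only among the
single-minded bidders in `T`. -/
noncomputable def smOPT (m : ℕ) {n : ℕ} (d : Fin n → ℕ) (x : Fin n → ℝ)
    (T : Finset (Fin n)) : ℝ :=
  sSup {w : ℝ | ∃ q : Fin n → ℕ, (∑ i ∈ T, q i) ≤ m ∧
    w = ∑ i ∈ T.filter (fun i => d i ≤ q i), x i}

/-- The welfare of the uniform-pricing phase of the Single-Minded mechanism: given coins
`σ`, the sampled set is `S = {i : σ i = true}`, the per-item price is
`p = OPT(S)/(10m)`, and the bidders outside `S` are processed in increasing index order,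
each purchasing her demand `d i` (contributing `x i`) iff `d i` items remain and
`x i > p · d i`. -/
noncomputable def smWelfare (m : ℕ) {n : ℕ} (d : Fin n → ℕ) (x : Fin n → ℝ)
    (σ : Fin n → Bool) : ℝ :=
  (((List.finRange n).filter (fun i => !σ i)).foldl
    (fun wr i =>
      if d i ≤ wr.2 ∧
          (smOPT m d x (Finset.univ.filter fun j => σ j = true) / (10 * m)) * d i < x i
      then (wr.1 + x i, wr.2 - d i) else wr)
    ((0 : ℝ), m)).1

/-- The set of welfares of feasible allocations is finite. -/
lemma smOPT_set_finite (m : ℕ) {n : ℕ} (d : Fin n → ℕ) (x : Fin n → ℝ) (T : Finset (Fin n)) :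
    {w : ℝ | ∃ q : Fin n → ℕ, (∑ i ∈ T, q i) ≤ m ∧
      w = ∑ i ∈ T.filter (fun i => d i ≤ q i), x i}.Finite := by
  refine (Set.finite_range fun U : Finset (Fin n) => ∑ i ∈ U, x i).subset ?_
  rintro w ⟨q, -, rfl⟩
  exact ⟨_, rfl⟩

lemma le_smOPT (m : ℕ) {n : ℕ} (d : Fin n → ℕ) (x : Fin n → ℝ) (T : Finset (Fin n))
    (q : Fin n → ℕ) (hq : ∑ i ∈ T, q i ≤ m) :
    ∑ i ∈ T.filter (fun i => d i ≤ q i), x i ≤ smOPT m d x T :=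
  le_csSup (smOPT_set_finite m d x T).bddAbove ⟨q, hq, rfl⟩

/-- The optimal welfare is attained. -/
lemma exists_smOPT_eq (m : ℕ) {n : ℕ} (d : Fin n → ℕ) (x : Fin n → ℝ) (T : Finset (Fin n)) :
    ∃ q : Fin n → ℕ, (∑ i ∈ T, q i) ≤ m ∧
      smOPT m d x T = ∑ i ∈ T.filter (fun i => d i ≤ q i), x i :=
  Set.Nonempty.csSup_mem (s := {w : ℝ | ∃ q : Fin n → ℕ, (∑ i ∈ T, q i) ≤ m ∧
    w = ∑ i ∈ T.filter (fun i => d i ≤ q i), x i}) ⟨_, fun _ => 0, by simp, rfl⟩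
    (smOPT_set_finite m d x T)

lemma smOPT_le_smOPT_univ (m : ℕ) {n : ℕ} (d : Fin n → ℕ) (x : Fin n → ℝ)
    (hx : ∀ i, 0 ≤ x i) (T : Finset (Fin n)) :
    smOPT m d x T ≤ smOPT m d x Finset.univ := by
  obtain ⟨q, hq, h⟩ := exists_smOPT_eq m d x T
  rw [h]
  refine le_trans (Finset.sum_le_sum_of_subset_of_nonneg ?_ fun i _ _ => hx i)
    (le_smOPT m d x Finset.univ (fun i => if i ∈ T then q i else 0) ?_)
  · intro i hi
    simp only [Finset.mem_filter, Finset.mem_univ, true_and] at hi ⊢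
    rw [if_pos hi.1]
    exact hi.2
  · simpa using hq

/-- A set of bidders with total demand at most `m` bounds `smOPT` from below. -/
lemma sum_inter_le_smOPT (m : ℕ) {n : ℕ} (d : Fin n → ℕ) (x : Fin n → ℝ)
    (hx : ∀ i, 0 ≤ x i) (O T : Finset (Fin n)) (hO : ∑ i ∈ O, d i ≤ m) :
    ∑ i ∈ O ∩ T, x i ≤ smOPT m d x T := by
  refine le_trans (Finset.sum_le_sum_of_subset_of_nonneg ?_ fun i _ _ => hx i)
    (le_smOPT m d x T (fun i => if i ∈ O then d i else 0) ?_)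
  · intro i hi
    rw [Finset.mem_inter] at hi
    simp [hi.1, hi.2]
  · rw [← Finset.sum_filter]
    refine le_trans (Finset.sum_le_sum_of_subset fun i hi => ?_) hO
    exact (Finset.mem_filter.1 hi).2

/-- Greedy sale at per-item price `p`: welfare and remaining supply after processing a list of
bidders. -/
noncomputable def sellAtPrice {ι : Type*} (d : ι → ℕ) (x : ι → ℝ) (p : ℝ) (l : List ι)
    (s : ℝ × ℕ) : ℝ × ℕ :=
  l.foldl (fun wr i => if d i ≤ wr.2 ∧ p * d i < x i then (wr.1 + x i, wr.2 - d i) else wr) s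

section sellAtPrice

variable {ι : Type*} (d : ι → ℕ) (x : ι → ℝ) (p : ℝ)

lemma sellAtPrice_cons_pos {i : ι} {s : ℝ × ℕ} (h : d i ≤ s.2 ∧ p * d i < x i) (l : List ι) :
    sellAtPrice d x p (i :: l) s = sellAtPrice d x p l (s.1 + x i, s.2 - d i) := by
  simp only [sellAtPrice, List.foldl_cons, if_pos h]

lemma sellAtPrice_cons_neg {i : ι} {s : ℝ × ℕ} (h : ¬(d i ≤ s.2 ∧ p * d i < x i))
    (l : List ι) :
    sellAtPrice d x p (i :: l) s = sellAtPrice d x p l s := by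
  simp only [sellAtPrice, List.foldl_cons, if_neg h]

lemma sellAtPrice_snd_le (l : List ι) (s : ℝ × ℕ) : (sellAtPrice d x p l s).2 ≤ s.2 := by
  induction l generalizing s with
  | nil => exact le_rfl
  | cons i l ih =>
    by_cases h : d i ≤ s.2 ∧ p * d i < x i
    · rw [sellAtPrice_cons_pos d x p h]
      exact (ih _).trans (Nat.sub_le _ _)
    · rw [sellAtPrice_cons_neg d x p h]
      exact ih s

/-- Welfare is at least revenue. -/
lemma revenue_le_sellAtPrice (l : List ι) (s : ℝ × ℕ) :
    s.1 + p * (s.2 - (sellAtPrice d x p l s).2) ≤ (sellAtPrice d x p l s).1 := by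
  induction l generalizing s with
  | nil => simp [sellAtPrice]
  | cons i l ih =>
    by_cases h : d i ≤ s.2 ∧ p * d i < x i
    · rw [sellAtPrice_cons_pos d x p h]
      have := ih (s.1 + x i, s.2 - d i)
      simp only [Nat.cast_sub h.1] at this
      linarith [h.2]
    · rw [sellAtPrice_cons_neg d x p h]
      exact ih s

/-- Either an interested bidder finds too little supply left, or all interested bidders buy. -/
lemma sellAtPrice_unserved_or_le (l : List ι) (s : ℝ × ℕ) :
    (∃ i, p * d i < x i ∧ (sellAtPrice d x p l s).2 < d i) ∨
      s.1 + ((l.filter fun i => p * d i < x i).map x).sum ≤ (sellAtPrice d x p l s).1 := by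
  induction l generalizing s with
  | nil => simp [sellAtPrice]
  | cons i l ih =>
    by_cases h : d i ≤ s.2 ∧ p * d i < x i
    · rw [sellAtPrice_cons_pos d x p h]
      refine (ih _).imp_right fun h' => ?_
      rw [List.filter_cons_of_pos (by simpa using h.2), List.map_cons, List.sum_cons]
      linarith
    · rw [sellAtPrice_cons_neg d x p h]
      by_cases hi : p * d i < x i
      · exact Or.inl ⟨i, hi, (sellAtPrice_snd_le d x p l s).trans_lt
          (not_le.1 fun h' => h ⟨h', hi⟩)⟩
      · rw [List.filter_cons_of_neg (by simpa using hi)]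
        exact ih s

end sellAtPrice

lemma smWelfare_eq_sellAtPrice (m : ℕ) {n : ℕ} (d : Fin n → ℕ) (x : Fin n → ℝ)
    (σ : Fin n → Bool) :
    smWelfare m d x σ = (sellAtPrice d x
      (smOPT m d x (Finset.univ.filter fun j => σ j = true) / (10 * m))
      ((List.finRange n).filter fun i => !σ i) (0, m)).1 := rfl

lemma smOPT_nonneg (m : ℕ) {n : ℕ} (d : Fin n → ℕ) (x : Fin n → ℝ) (hx : ∀ i, 0 ≤ x i)
    (T : Finset (Fin n)) : 0 ≤ smOPT m d x T :=
  (Finset.sum_nonneg fun i _ => hx i).trans (le_smOPT m d x T (fun _ => 0) (by simp))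

lemma smWelfare_nonneg (m : ℕ) {n : ℕ} (d : Fin n → ℕ) (x : Fin n → ℝ) (hx : ∀ i, 0 ≤ x i)
    (σ : Fin n → Bool) : 0 ≤ smWelfare m d x σ := by
  rw [smWelfare_eq_sellAtPrice]
  refine le_trans ?_ (revenue_le_sellAtPrice d x _ _ _)
  have hp := smOPT_nonneg m d x hx (Finset.univ.filter fun j => σ j = true)
  have hr : ((sellAtPrice d x _ _ _).2 : ℝ) ≤ m := Nat.cast_le.2 (sellAtPrice_snd_le d x
    (smOPT m d x (Finset.univ.filter fun j => σ j = true) / (10 * m))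
    ((List.finRange n).filter fun i => !σ i) (0, m))
  rw [zero_add]
  exact mul_nonneg (by positivity) (sub_nonneg.2 hr)

/-- Welfare of the pricing phase, in terms of how an optimal set `O` of bidders is split
by the sampling. -/
lemma smWelfare_lower_bound (m : ℕ) (hm : 1 ≤ m) {n : ℕ} (d : Fin n → ℕ) (x : Fin n → ℝ)
    (hx : ∀ i, 0 ≤ x i) (V : ℝ) (hV : ∀ i, x i ≤ V) (O : Finset (Fin n))
    (hO : ∑ i ∈ O, d i ≤ m) (σ : Fin n → Bool) :
    (∑ i ∈ O with σ i = true, x i) / 10 - V ≤ smWelfare m d x σ ∨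
      (∑ i ∈ O with ¬ σ i = true, x i) - smOPT m d x Finset.univ / 10 ≤
        smWelfare m d x σ := by
  rw [smWelfare_eq_sellAtPrice]
  set S : Finset (Fin n) := Finset.univ.filter fun j => σ j = true with hS
  set p : ℝ := smOPT m d x S / (10 * m) with hp
  set l := (List.finRange n).filter fun i => !σ i with hl
  have hm' : (0 : ℝ) < m := by exact_mod_cast hm
  have hp0 : 0 ≤ p := div_nonneg (smOPT_nonneg m d x hx S) (by positivity)
  have hpm : p * m = smOPT m d x S / 10 := by rw [hp]; field_simp
  rcases sellAtPrice_unserved_or_le d x p l (0, m) with ⟨i, hi, hr⟩ | h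
  · left
    have hrev := revenue_le_sellAtPrice d x p l (0, m)
    have hr' : ((sellAtPrice d x p l (0, m)).2 : ℝ) ≤ d i := by exact_mod_cast hr.le
    have hA := sum_inter_le_smOPT m d x hx O S hO
    rw [hS, Finset.inter_filter, Finset.inter_univ, ← hS] at hA
    have := mul_le_mul_of_nonneg_left hr' hp0
    simp only at hrev
    linarith [hV i]
  · right
    have hnd : (l.filter fun i => p * d i < x i).Nodup :=
      ((List.nodup_finRange n).filter _).filter _
    rw [← List.sum_toFinset x hnd, zero_add] at h
    refine le_trans ?_ h
    have hsub : (O.filter fun i => ¬ σ i = true).filter (fun i => p * d i < x i) ⊆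
        (l.filter fun i => p * d i < x i).toFinset := by
      intro i hi
      simp only [Finset.mem_filter] at hi
      simp [hl, hi.1.2, hi.2]
    refine le_trans ?_ (Finset.sum_le_sum_of_subset_of_nonneg hsub fun i _ _ => hx i)
    have hdem : ∑ i ∈ O with ¬ σ i = true, p * (d i : ℝ) ≤ smOPT m d x Finset.univ / 10 := by
      have h1 : ∑ i ∈ O with ¬ σ i = true, (d i : ℝ) ≤ m := by
        exact_mod_cast (Finset.sum_le_sum_of_subset (Finset.filter_subset _ O)).trans hO
      rw [← Finset.mul_sum]
      linarith [mul_le_mul_of_nonneg_left h1 hp0, smOPT_le_smOPT_univ m d x hx S]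
    have hsum : ∑ i ∈ O with ¬ σ i = true, (x i - p * (d i : ℝ)) ≤
        ∑ i ∈ (O.filter fun i => ¬ σ i = true).filter (fun i => p * d i < x i), x i := by
      rw [Finset.sum_filter (fun i => p * (d i : ℝ) < x i)]
      refine Finset.sum_le_sum fun i _ => ?_
      have : 0 ≤ p * (d i : ℝ) := by positivity
      split_ifs <;> linarith
    rw [Finset.sum_sub_distrib] at hsum
    linarith

/-- The sign of a coin. -/
noncomputable def coinSign (b : Bool) : ℝ := if b = true then 1 else -1

lemma sum_coinSign_mul_coinSign {ι : Type*} [Fintype ι] [DecidableEq ι] (i j : ι) :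
    ∑ σ : ι → Bool, coinSign (σ i) * coinSign (σ j) =
      if i = j then (Fintype.card (ι → Bool) : ℝ) else 0 := by
  split_ifs with hij
  · subst hij
    have : ∀ b, coinSign b * coinSign b = 1 := by simp [coinSign]
    simp [this]
  · refine Finset.sum_involution (fun σ _ => Function.update σ i (!σ i)) ?_ ?_ ?_ ?_
    · intro σ _
      rw [Function.update_self, Function.update_of_ne (Ne.symm hij)]
      cases σ i <;> cases σ j <;> simp [coinSign]
    · intro σ _ _ h
      have := congrFun h i
      simp at this
    · intros
      exact Finset.mem_univ _
    · intro σ _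
      simp

/-- The second moment of a Rademacher sum. -/
lemma sum_sq_sum_coinSign {ι : Type*} [Fintype ι] [DecidableEq ι] (O : Finset ι) (x : ι → ℝ) :
    ∑ σ : ι → Bool, (∑ i ∈ O, coinSign (σ i) * x i) ^ 2 =
      Fintype.card (ι → Bool) * ∑ i ∈ O, x i ^ 2 := by
  have h : ∀ σ : ι → Bool, (∑ i ∈ O, coinSign (σ i) * x i) ^ 2 =
      ∑ i ∈ O, ∑ j ∈ O, coinSign (σ i) * coinSign (σ j) * (x i * x j) := by
    intro σ
    rw [sq, Finset.sum_mul_sum]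
    exact Finset.sum_congr rfl fun i _ => Finset.sum_congr rfl fun j _ => by ring
  simp_rw [h]
  rw [Finset.sum_comm, Finset.mul_sum]
  refine Finset.sum_congr rfl fun i hi => ?_
  rw [Finset.sum_comm]
  simp_rw [← Finset.sum_mul, sum_coinSign_mul_coinSign, ite_mul, zero_mul]
  rw [Finset.sum_ite_eq, if_pos hi, sq]

lemma sum_filter_add_sub_coinSign {ι : Type*} (O : Finset ι) (x : ι → ℝ) (σ : ι → Bool) :
    ∑ i ∈ O with σ i = true, x i =
        (∑ i ∈ O, x i + ∑ i ∈ O, coinSign (σ i) * x i) / 2 ∧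
      ∑ i ∈ O with ¬ σ i = true, x i =
        (∑ i ∈ O, x i - ∑ i ∈ O, coinSign (σ i) * x i) / 2 := by
  rw [Finset.sum_filter, Finset.sum_filter, ← Finset.sum_add_distrib, ← Finset.sum_sub_distrib,
    Finset.sum_div, Finset.sum_div]
  constructor <;> refine Finset.sum_congr rfl fun i _ => ?_ <;> cases σ i <;>
    simp [coinSign]

/-- The Single-Minded mechanism, which with probability `1/2` sells the grand bundle to a
highest-value bidder and with probability `1/2` runs the sample-and-price phase, is a
`400`-approximation to the optimal welfare. -/
theorem single_minded_400_approx (m n : ℕ) (hm : 1 ≤ m) (hn : 0 < n)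
    (d : Fin n → ℕ) (hd : ∀ i, 1 ≤ d i ∧ d i ≤ m)
    (x : Fin n → ℝ) (hx : ∀ i, 0 ≤ x i) :
    smOPT m d x Finset.univ / 400 ≤
      (1 / 2) * (⨆ i, x i) +
      (1 / 2) * ((∑ σ : Fin n → Bool, smWelfare m d x σ) /
        (Fintype.card (Fin n → Bool))) := by
  set V := ⨆ i, x i
  have hV : ∀ i, x i ≤ V := le_ciSup (Set.finite_range x).bddAbove
  have hV0 : 0 ≤ V := (hx ⟨0, hn⟩).trans (hV _)
  obtain ⟨q, hq, hopt⟩ := exists_smOPT_eq m d x Finset.univ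
  set O := Finset.univ.filter fun i => d i ≤ q i with hO
  have hOm : ∑ i ∈ O, d i ≤ m :=
    ((Finset.sum_le_sum fun i hi => (Finset.mem_filter.1 hi).2).trans
      (Finset.sum_le_sum_of_subset (Finset.filter_subset _ _))).trans hq
  set B := smOPT m d x Finset.univ
  set N : ℝ := (Fintype.card (Fin n → Bool) : ℝ)
  have hN : 0 < N := Nat.cast_pos.2 Fintype.card_pos
  have hW0 : 0 ≤ (∑ σ : Fin n → Bool, smWelfare m d x σ) / N :=
    div_nonneg (Finset.sum_nonneg fun σ _ => smWelfare_nonneg m d x hx σ) hN.le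
  rcases le_or_gt (B / 200) V with hBV | hBV
  · linarith
  have hB : 0 < B := by linarith
  have hpt : ∀ σ : Fin n → Bool,
      B ^ 2 / 50 - (∑ i ∈ O, coinSign (σ i) * x i) ^ 2 ≤ B * smWelfare m d x σ := by
    intro σ
    have h := smWelfare_lower_bound m hm d x hx V hV O hOm σ
    obtain ⟨h1, h2⟩ := sum_filter_add_sub_coinSign O x σ
    rw [h1, h2, ← hopt] at h
    set D := ∑ i ∈ O, coinSign (σ i) * x i
    rcases h with h | h
    · have h3 := mul_le_mul_of_nonneg_left h hB.le
      have h4 := mul_lt_mul_of_pos_left hBV hB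
      nlinarith [sq_nonneg (D + B / 40), sq_nonneg B]
    · have h3 := mul_le_mul_of_nonneg_left h hB.le
      nlinarith [sq_nonneg (D - B / 4), sq_nonneg B]
  have hsum := Finset.sum_le_sum fun σ (_ : σ ∈ Finset.univ) => hpt σ
  rw [Finset.sum_sub_distrib, sum_sq_sum_coinSign, ← Finset.mul_sum, Finset.sum_const,
    nsmul_eq_mul, Finset.card_univ] at hsum
  have hsq : ∑ i ∈ O, x i ^ 2 ≤ V * B := by
    rw [hopt, Finset.mul_sum]
    refine Finset.sum_le_sum fun i _ => ?_
    rw [sq]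
    exact mul_le_mul_of_nonneg_right (hV i) (hx i)
  have hE : B / 200 ≤ (∑ σ : Fin n → Bool, smWelfare m d x σ) / N := by
    rw [le_div_iff₀ hN]
    refine le_of_mul_le_mul_left ?_ hB
    refine le_trans ?_ hsum
    change B * (B / 200 * N) ≤ N * (B ^ 2 / 50) - N * _
    have h5 : ∑ i ∈ O, x i ^ 2 ≤ B ^ 2 / 200 := by
      nlinarith [mul_lt_mul_of_pos_right hBV hB]
    nlinarith [mul_le_mul_of_nonneg_left h5 hN.le, mul_pos hN (pow_pos hB 2)]
  linarith
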